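/- Let f, g ∈ ℂ[z] and suppose the monodromy group G of the deformation f + εg is imprimitive. Then there exist polynomials F ∈ ℂ[z,ε] and h ∈ ℂ[z], both of degree greater than 1 in z, with F affine in ε (F(z,ε) = F₀(z) + εF₁(z) for some F₀, F₁ ∈ ℂ[z]), such that f(z) + εg(z) = F(h(z), ε); equivalently, f = F₀ ∘ h and g = F₁ ∘ h have a nontrivial common polynomial composition factor h. -/

import Mathlib

open Polynomial OnePoint

noncomputable section

/-- The degree `n` in `z` of the deformation `f + ε g`. -/
def defDeg (f g : Polynomial ℂ) : ℕ := max f.natDegree g.natDegree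

/-- `c(ε)`: the leading coefficient of `f + ε g` as a polynomial in `z`. -/
def leadC (f g : Polynomial ℂ) (ε : ℂ) : ℂ :=
  f.coeff (defDeg f g) + ε * g.coeff (defDeg f g)

/-- The finite part of `Σ`: the set of `(t, ε) ∈ ℂ²` with `c(ε) D(t,ε) = 0`,
`D` being the discriminant of `f + ε g - t` in `z`; equivalently, `c(ε) = 0` or
`f + ε g - t` has a multiple root. -/
def sigmaFin (f g : Polynomial ℂ) : Set (ℂ × ℂ) :=
  {p | leadC f g p.2 = 0 ∨ ∃ w : ℂ,
    f.eval w + p.2 * g.eval w = p.1 ∧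
    f.derivative.eval w + p.2 * g.derivative.eval w = 0}

/-- `Σ = {(t,ε) : c(ε)D(t,ε) = 0} ∪ {∞} × ℂ ⊆ ℂP¹ × ℂ`. -/
def sigmaSet (f g : Polynomial ℂ) : Set (OnePoint ℂ × ℂ) :=
  {p | p.1 = ∞ ∨ ∃ t : ℂ, p.1 = (t : OnePoint ℂ) ∧ (t, p.2) ∈ sigmaFin f g}

/-- The fiber of `H(z,ε) = (f(z) + ε g(z), ε)` over `(t₀, ε₀)`. -/
abbrev theFiber (f g : Polynomial ℂ) (t₀ ε₀ : ℂ) : Type :=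
  {w : ℂ // f.eval w + ε₀ * g.eval w = t₀}

/-- A permutation of the fiber over `(t₀,ε₀)` is a monodromy permutation if it is
realized by lifting some closed path in `(ℂP¹ × ℂ) \ Σ` based at `(t₀,ε₀)`. -/
def IsMonodromyPerm (f g : Polynomial ℂ) (t₀ ε₀ : ℂ)
    (σ : Equiv.Perm (theFiber f g t₀ ε₀)) : Prop :=
  ∃ γ : ℝ → OnePoint ℂ × ℂ,
    ContinuousOn γ (Set.Icc 0 1) ∧ γ 0 = ((t₀ : OnePoint ℂ), ε₀) ∧
    γ 1 = ((t₀ : OnePoint ℂ), ε₀) ∧ (∀ s ∈ Set.Icc (0 : ℝ) 1, γ s ∉ sigmaSet f g) ∧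
    ∀ x : theFiber f g t₀ ε₀, ∃ l : ℝ → ℂ,
      ContinuousOn l (Set.Icc 0 1) ∧ l 0 = x.1 ∧ l 1 = (σ x).1 ∧
      ∀ s ∈ Set.Icc (0 : ℝ) 1,
        ((f.eval (l s) + (γ s).2 * g.eval (l s) : ℂ) : OnePoint ℂ) = (γ s).1

/-- The monodromy group `G` of the deformation `f + ε g`: the subgroup of the
symmetric group of the fiber generated by all monodromy permutations. -/
def MonodromyGroup (f g : Polynomial ℂ) (t₀ ε₀ : ℂ) :
    Subgroup (Equiv.Perm (theFiber f g t₀ ε₀)) :=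
  Subgroup.closure {σ | IsMonodromyPerm f g t₀ ε₀ σ}

/-- The set of critical values of a polynomial `P`. -/
def polyCrit (P : Polynomial ℂ) : Set ℂ :=
  {t | ∃ w : ℂ, P.eval w = t ∧ P.derivative.eval w = 0}

/-- The fiber `P⁻¹(t)` of a polynomial `P`. -/
abbrev polyFiber (P : Polynomial ℂ) (t : ℂ) : Type := {w : ℂ // P.eval w = t}

/-- Monodromy permutations of a single polynomial `P`: permutations of the fiber
`P⁻¹(t₁)` realized by lifting closed paths in `ℂ \ {critical values}`. -/
def IsPolyMonodromyPerm (P : Polynomial ℂ) (t₁ : ℂ)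
    (σ : Equiv.Perm (polyFiber P t₁)) : Prop :=
  ∃ γ : ℝ → ℂ, ContinuousOn γ (Set.Icc 0 1) ∧ γ 0 = t₁ ∧ γ 1 = t₁ ∧
    (∀ s ∈ Set.Icc (0 : ℝ) 1, γ s ∉ polyCrit P) ∧
    ∀ x : polyFiber P t₁, ∃ l : ℝ → ℂ, ContinuousOn l (Set.Icc 0 1) ∧
      l 0 = x.1 ∧ l 1 = (σ x).1 ∧ ∀ s ∈ Set.Icc (0 : ℝ) 1, P.eval (l s) = γ s

/-- The monodromy group of a single polynomial `P`, based at `t₁`. -/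
def PolyMonodromyGroup (P : Polynomial ℂ) (t₁ : ℂ) :
    Subgroup (Equiv.Perm (polyFiber P t₁)) :=
  Subgroup.closure {σ | IsPolyMonodromyPerm P t₁ σ}

/-- The group homomorphism `Perm X →* Perm Y` induced by a bijection `e : X ≃ Y`. -/
def permMapHom {X Y : Type*} (e : X ≃ Y) : Equiv.Perm X →* Equiv.Perm Y where
  toFun σ := (e.symm.trans σ).trans e
  map_one' := by ext y; simp
  map_mul' σ τ := by ext y; simp [Equiv.Perm.mul_apply]

/-- Two permutation groups are permutationally isomorphic if some bijection of the
underlying sets conjugates one onto the other. -/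
def PermIsoOn {X Y : Type*} (G : Subgroup (Equiv.Perm X))
    (H : Subgroup (Equiv.Perm Y)) : Prop :=
  ∃ e : X ≃ Y, G.map (permMapHom e) = H

/-- A permutation group `G ≤ Perm X` is two-transitive if it acts transitively on
ordered pairs of distinct points. -/
def IsTwoTransitive {X : Type*} (G : Subgroup (Equiv.Perm X)) : Prop :=
  ∀ x₁ x₂ y₁ y₂ : X, x₁ ≠ x₂ → y₁ ≠ y₂ → ∃ σ ∈ G, σ x₁ = y₁ ∧ σ x₂ = y₂

/-- A permutation group `G ≤ Perm X` is imprimitive if there is a proper subset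
`B ⊆ X` with more than one element such that every `σ ∈ G` satisfies
`σ(B) ∩ B = ∅` or `σ(B) = B`. -/
def IsImprimitive {X : Type*} (G : Subgroup (Equiv.Perm X)) : Prop :=
  ∃ B : Set X, (∃ x ∈ B, ∃ y ∈ B, x ≠ y) ∧ B ≠ Set.univ ∧
    ∀ σ ∈ G, ((fun x => σ x) '' B) ∩ B = ∅ ∨ (fun x => σ x) '' B = B


section CommonFactor

/-- The cofactor of `a - b` in `a ^ k - b ^ k`, for monic `a` and `b` of degree `m`. -/
theorem natDegree_geom_sum₂_le {R : Type*} [CommRing R] {a b : R[X]} {m k : ℕ}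
    (ham : a.natDegree = m) (hbm : b.natDegree = m) :
    (∑ i ∈ Finset.range k, a ^ i * b ^ (k - 1 - i)).natDegree ≤ (k - 1) * m := by
  refine natDegree_sum_le_of_forall_le _ _ fun i hi => ?_
  have hi' : i + (k - 1 - i) = k - 1 := by have := Finset.mem_range.1 hi; omega
  calc (a ^ i * b ^ (k - 1 - i)).natDegree
      ≤ i * m + (k - 1 - i) * m :=
        natDegree_mul_le_of_le (natDegree_pow_le_of_le i ham.le)
          (natDegree_pow_le_of_le _ hbm.le)
    _ = (k - 1) * m := by rw [← add_mul, hi']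

theorem coeff_geom_sum₂ {R : Type*} [CommRing R] {a b : R[X]} {m k : ℕ}
    (ha : a.Monic) (hb : b.Monic) (ham : a.natDegree = m) (hbm : b.natDegree = m) :
    (∑ i ∈ Finset.range k, a ^ i * b ^ (k - 1 - i)).coeff ((k - 1) * m) = k := by
  nontriviality R
  rw [finsetSum_coeff, Finset.sum_congr rfl (g := fun _ => (1 : R)), Finset.sum_const]
  · simp
  intro i hi
  have hi' : i + (k - 1 - i) = k - 1 := by have := Finset.mem_range.1 hi; omega
  have hmon : (a ^ i * b ^ (k - 1 - i)).Monic := (ha.pow i).mul (hb.pow _)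
  have hdeg : (a ^ i * b ^ (k - 1 - i)).natDegree = (k - 1) * m := by
    rw [(ha.pow i).natDegree_mul (hb.pow _), ha.natDegree_pow, hb.natDegree_pow, ham, hbm,
      ← add_mul, hi']
  rw [← hdeg]
  exact hmon.coeff_natDegree

/-- A monic polynomial is determined by its constant term and the top coefficients of a power. -/
theorem Polynomial.Monic.eq_of_natDegree_pow_sub_pow_le {R : Type*} [CommRing R] [IsDomain R]
    [CharZero R] {a b : R[X]} {m k : ℕ} (hk : k ≠ 0) (ha : a.Monic) (hb : b.Monic)
    (ham : a.natDegree = m) (hbm : b.natDegree = m) (h0 : a.coeff 0 = b.coeff 0)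
    (h : (a ^ k - b ^ k).natDegree ≤ (k - 1) * m) : a = b := by
  by_contra hab
  set S := ∑ i ∈ Finset.range k, a ^ i * b ^ (k - 1 - i) with hS
  have hc : S.coeff ((k - 1) * m) = k := coeff_geom_sum₂ ha hb ham hbm
  have hS0 : S.coeff ((k - 1) * m) ≠ 0 := by rw [hc]; exact_mod_cast hk
  have hle := le_natDegree_of_ne_zero hS0
  have hSne : S ≠ 0 := fun h => hS0 (by simp [h])
  have hmul : S * (a - b) = a ^ k - b ^ k := geom_sum₂_mul a b k
  rw [← hmul, Polynomial.natDegree_mul hSne (sub_ne_zero.2 hab)] at h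
  have hd : (a - b).natDegree = 0 := by omega
  rw [eq_C_of_natDegree_eq_zero hd, coeff_sub, h0, sub_self, C_0] at hmul
  rw [mul_zero, eq_comm] at hmul
  apply hab
  rw [← sub_eq_zero, eq_C_of_natDegree_eq_zero hd, coeff_sub, h0, sub_self, C_0]

/-- Existence of approximate roots: a monic polynomial of degree `k * m` agrees with the `k`-th
power of a monic polynomial of degree `m` up to terms of degree at most `(k - 1) * m`. -/
theorem exists_approximate_root {R : Type*} [CommRing R] [Nontrivial R] {P : R[X]} {m k : ℕ}
    {u : R} (hu : u * k = 1) (hk : k ≠ 0) (hm : m ≠ 0) (hP : P.Monic)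
    (hPd : P.natDegree = k * m) :
    ∃ H : R[X], H.Monic ∧ H.natDegree = m ∧ H.coeff 0 = 0 ∧
      (P - H ^ k).natDegree ≤ (k - 1) * m := by
  obtain ⟨k, rfl⟩ := Nat.exists_eq_succ_of_ne_zero hk
  suffices h : ∀ j < m, ∃ H : R[X], H.Monic ∧ H.natDegree = m ∧ H.coeff 0 = 0 ∧
      (P - H ^ (k + 1)).natDegree ≤ k * m + (m - j - 1) by
    obtain ⟨H, h1, h2, h3, h4⟩ := h (m - 1) (by omega)
    exact ⟨H, h1, h2, h3, h4.trans (by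
      rw [Nat.succ_sub_one]
      omega)⟩
  intro j
  induction j with
  | zero =>
    intro _
    refine ⟨X ^ m, monic_X_pow m, natDegree_X_pow m, by simp [coeff_X_pow, hm.symm], ?_⟩
    rw [natDegree_le_iff_coeff_eq_zero]
    intro N hN
    have hN' : (k + 1) * m ≤ N := by rw [add_mul]; omega
    rw [← pow_mul, coeff_sub, coeff_X_pow]
    rcases hN'.eq_or_lt with rfl | hlt
    · have := hP.coeff_natDegree
      rw [hPd, Nat.succ_eq_add_one] at this
      rw [this, if_pos (mul_comm _ _), sub_self]
    · rw [coeff_eq_zero_of_natDegree_lt (by rw [hPd]; exact hlt), if_neg, sub_zero]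
      rw [mul_comm]
      exact hlt.ne'
  | succ j ih =>
    intro hj
    obtain ⟨H, hH, hHd, hH0, hHP⟩ := ih (by omega)
    set e := m - j - 1 with he
    have he1 : 1 ≤ e := by omega
    set c := (P - H ^ (k + 1)).coeff (k * m + e) with hc
    set T : R[X] := C (u * c) * X ^ e with hT
    have hTd : T.natDegree ≤ e := natDegree_C_mul_X_pow_le _ _
    have hTlt : T.degree < H.degree := by
      rw [degree_eq_natDegree hH.ne_zero, hHd]
      exact (degree_le_of_natDegree_le hTd).trans_lt (Nat.cast_lt.2 (by omega))
    have hH' : (H + T).Monic := hH.add_of_left hTlt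
    have hH'd : (H + T).natDegree = m := by
      rw [natDegree_add_eq_left_of_degree_lt hTlt, hHd]
    refine ⟨H + T, hH', hH'd, ?_, ?_⟩
    · rw [coeff_add, hH0, hT, coeff_C_mul_X_pow, if_neg (by omega), add_zero]
    have hgs := natDegree_geom_sum₂_le (k := k + 1) hH'd hHd
    have hgc := coeff_geom_sum₂ (k := k + 1) hH' hH hH'd hHd
    have hmul := geom_sum₂_mul (H + T) H (k + 1)
    set S := ∑ i ∈ Finset.range (k + 1), (H + T) ^ i * H ^ (k + 1 - 1 - i) with hS
    rw [Nat.add_sub_cancel] at hgs hgc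
    rw [add_sub_cancel_left] at hmul
    have hsplit : P - (H + T) ^ (k + 1) = (P - H ^ (k + 1)) - S * T := by rw [hmul]; ring
    rw [hsplit, natDegree_le_iff_coeff_eq_zero]
    intro N hN
    have hN' : k * m + e ≤ N := by omega
    rcases hN'.eq_or_lt with rfl | hlt
    · rw [coeff_sub, ← hc, coeff_mul_add_eq_of_natDegree_le hgs hTd, hgc, hT,
        coeff_C_mul_X_pow, if_pos rfl]
      linear_combination (-c) * hu
    · rw [coeff_sub, coeff_eq_zero_of_natDegree_lt (hHP.trans_lt hlt),
        coeff_eq_zero_of_natDegree_lt ((natDegree_mul_le_of_le hgs hTd).trans_lt hlt), sub_zero]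

theorem Polynomial.Monic.natDegree_comp_sub_pow_le {R : Type*} [CommRing R] {F h : R[X]}
    (hF : F.Monic) : (F.comp h - h ^ F.natDegree).natDegree ≤ (F.natDegree - 1) * h.natDegree := by
  have : F.comp h - h ^ F.natDegree = (F - X ^ F.natDegree).comp h := by simp
  rw [this]
  refine natDegree_comp_le.trans (Nat.mul_le_mul_right _ ?_)
  rw [natDegree_le_iff_coeff_eq_zero]
  intro N hN
  rw [coeff_sub, coeff_X_pow]
  rcases (by omega : F.natDegree ≤ N).eq_or_lt with rfl | hlt
  · simp [hF.coeff_natDegree]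
  · rw [coeff_eq_zero_of_natDegree_lt hlt, if_neg hlt.ne', sub_zero]

/-- A decomposition of a monic polynomial can be normalized. -/
theorem Polynomial.Monic.exists_normalized_comp {K : Type*} [Field K] {P F h : K[X]} (hP : P.Monic)
    (hPF : P = F.comp h) (hh : h.natDegree ≠ 0) :
    ∃ F' h' : K[X], F'.Monic ∧ h'.Monic ∧ h'.coeff 0 = 0 ∧ h'.natDegree = h.natDegree ∧
      P = F'.comp h' := by
  have hl : h.leadingCoeff ≠ 0 := leadingCoeff_ne_zero.2 fun h0 => hh (by simp [h0])
  set L : K[X] := C h.leadingCoeff * X + C (h.coeff 0) with hL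
  have hh' : (C h.leadingCoeff⁻¹ * (h - C (h.coeff 0))).natDegree = h.natDegree := by
    rw [natDegree_C_mul (inv_ne_zero hl), natDegree_sub_C]
  have hmon : (C h.leadingCoeff⁻¹ * (h - C (h.coeff 0))).Monic := by
    rw [Monic, Polynomial.leadingCoeff, hh', coeff_C_mul, coeff_sub, coeff_C, if_neg hh, sub_zero]
    exact inv_mul_cancel₀ hl
  have hcomp : P = (F.comp L).comp (C h.leadingCoeff⁻¹ * (h - C (h.coeff 0))) := by
    rw [hPF, comp_assoc]
    congr 1
    simp only [hL, add_comp, mul_comp, C_comp, X_comp]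
    rw [← mul_assoc, ← C_mul, mul_inv_cancel₀ hl]
    simp
  refine ⟨F.comp L, _, ?_, hmon, by simp, hh', hcomp⟩
  have := leadingCoeff_comp (p := F.comp L) (hh'.trans_ne hh)
  rw [← hcomp, hP.leadingCoeff, hmon.leadingCoeff, one_pow, mul_one] at this
  exact this.symm

/-- A polynomial in two variables of degree `0` in the first one is independent of it. -/
theorem exists_map_C_of_natDegree_swap_eq_zero {R : Type*} [CommRing R] {H : R[X][X]}
    (h : (Bivariate.swap H).natDegree = 0) : ∃ a : R[X], H = a.map C := by
  refine ⟨(Bivariate.swap H).coeff 0, ?_⟩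
  apply Bivariate.swap.injective
  rw [Bivariate.swap_map_C]
  exact eq_C_of_natDegree_eq_zero h

theorem eq_zero_of_infinite_specialize {H : ℂ[X][X]} {A : Set ℂ} (hA : A.Infinite)
    (h : ∀ δ ∈ A, H.map (evalRingHom δ) = 0) : H = 0 := by
  ext1 n
  refine eq_zero_of_infinite_isRoot _ (hA.mono fun δ hδ => ?_)
  have := congrArg (coeff · n) (h δ hδ)
  simpa using this

/-- If infinitely many members of the pencil `p + δ q`, with `p` monic of degree greater than that
of `q`, are compositions with inner factors of a fixed degree, then `p` and `q` have a common
composition factor of this degree. -/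
theorem exists_common_comp_of_infinite_monic {p q : ℂ[X]} {m : ℕ} {A : Set ℂ} (hA : A.Infinite)
    (hp : p.Monic) (hq : q.degree < p.degree) (hm : m ≠ 0) (hmp : m < p.natDegree)
    (h : ∀ δ ∈ A, ∃ F h : ℂ[X], h.natDegree = m ∧ p + C δ * q = F.comp h) :
    ∃ F₀ F₁ h : ℂ[X], h.natDegree = m ∧ p = F₀.comp h ∧ q = F₁.comp h := by
  have hδ (δ : ℂ) : (C δ * q).degree < p.degree := by
    rw [← smul_eq_C_mul]; exact (degree_smul_le δ q).trans_lt hq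
  have hmon (δ : ℂ) : (p + C δ * q).Monic := hp.add_of_left (hδ δ)
  have hdeg (δ : ℂ) : (p + C δ * q).natDegree = p.natDegree :=
    natDegree_add_eq_left_of_degree_lt (hδ δ)
  have h' : ∀ δ : A, ∃ F h : ℂ[X], F.Monic ∧ h.Monic ∧ h.coeff 0 = 0 ∧ h.natDegree = m ∧
      p + C δ.1 * q = F.comp h := by
    intro ⟨δ, hδA⟩
    obtain ⟨F, h, hh, hF⟩ := h δ hδA
    obtain ⟨F', h', h1, h2, h3, h4, h5⟩ := (hmon δ).exists_normalized_comp hF (hh.trans_ne hm)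
    exact ⟨F', h', h1, h2, h3, h4.trans hh, h5⟩
  choose F h hF hh hh0 hhm hFh using h'
  obtain ⟨δ₁, hδ₁⟩ := hA.nonempty
  set k := (F ⟨δ₁, hδ₁⟩).natDegree with hk
  have hkm (δ : A) : p.natDegree = (F δ).natDegree * m := by
    rw [← hdeg δ, hFh δ, natDegree_comp, hhm]
  have hFk (δ : A) : (F δ).natDegree = k :=
    Nat.eq_of_mul_eq_mul_right (Nat.pos_of_ne_zero hm) ((hkm δ).symm.trans (hkm _))
  have hpk : p.natDegree = k * m := hkm _
  have hk2 : 2 ≤ k := by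
    by_contra hlt
    have : k * m ≤ 1 * m := Nat.mul_le_mul_right m (by omega)
    omega
  suffices heq : ∃ δ δ' : A, δ ≠ δ' ∧ h δ = h δ' by
    obtain ⟨δ, δ', hne, heq⟩ := heq
    have hne' : δ.1 - δ'.1 ≠ 0 := sub_ne_zero.2 fun h => hne (Subtype.ext h)
    have e1 := hFh δ
    have e2 := hFh δ'
    rw [← heq] at e2
    have hqc : q = (C (δ.1 - δ'.1)⁻¹ * (F δ - F δ')).comp (h δ) := by
      rw [mul_comp, sub_comp, C_comp, ← e1, ← e2, add_sub_add_left_eq_sub, ← sub_mul, ← C_sub,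
        ← mul_assoc, ← C_mul, inv_mul_cancel₀ hne', C_1, one_mul]
    refine ⟨F δ - C δ.1 * (C (δ.1 - δ'.1)⁻¹ * (F δ - F δ')), _, h δ, hhm δ, ?_, hqc⟩
    rw [sub_comp, mul_comp, C_comp, ← hqc, ← e1, add_sub_cancel_right]
  set P : ℂ[X][X] := p.map C + C X * q.map C with hPdef
  have hPmap (δ : ℂ) : P.map (evalRingHom δ) = p + C δ * q := by
    have : (evalRingHom δ).comp C = RingHom.id ℂ := by ext; simp
    simp [hPdef, Polynomial.map_map, this]
  have hPlt : (C X * q.map C : ℂ[X][X]).degree < (p.map (C : ℂ →+* ℂ[X])).degree := by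
    refine (degree_mul_le _ _).trans_lt ?_
    rw [degree_C X_ne_zero, zero_add, hp.degree_map]
    exact degree_map_le.trans_lt hq
  have hPmon : P.Monic := (hp.map C).add_of_left hPlt
  have hPd : P.natDegree = k * m := by
    rw [hPdef, natDegree_add_eq_left_of_degree_lt hPlt, hp.natDegree_map, hpk]
  obtain ⟨H, hH, hHm, hH0, hHP⟩ := exists_approximate_root (u := C ((k : ℂ)⁻¹))
    (by rw [← C_eq_natCast, ← C_mul, inv_mul_cancel₀ (by norm_cast; omega), C_1])
    (by omega : k ≠ 0) hm hPmon hPd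
  have hHh (δ : A) : H.map (evalRingHom δ.1) = h δ := by
    refine Monic.eq_of_natDegree_pow_sub_pow_le (k := k) (by omega) (hH.map _) (hh δ)
      ((hH.natDegree_map _).trans hHm) (hhm δ) (by simp [coeff_map, hH0, hh0]) ?_
    have e1 : ((P - H ^ k).map (evalRingHom δ.1)).natDegree ≤ (k - 1) * m :=
      natDegree_map_le.trans hHP
    have e2 := (hF δ).natDegree_comp_sub_pow_le (h := h δ)
    rw [hFk, hhm, ← hFh] at e2
    rw [Polynomial.map_sub, hPmap, Polynomial.map_pow] at e1
    have := natDegree_sub_le_of_le e2 e1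
    rwa [max_self, sub_sub_sub_cancel_left] at this
  have hFX (δ : A) : p + C δ.1 * q - C ((p + C δ.1 * q).coeff 0)
      = h δ * ((F δ).divX.comp (h δ)) := by
    have : (p + C δ.1 * q).coeff 0 = (F δ).coeff 0 := by
      rw [hFh δ, coeff_zero_eq_eval_zero, eval_comp, ← coeff_zero_eq_eval_zero, hh0,
        ← coeff_zero_eq_eval_zero]
    rw [this, hFh δ]
    conv_lhs => rw [← divX_mul_X_add (F δ)]
    simp only [add_comp, mul_comp, X_comp, C_comp, coeff_add, coeff_mul_X_zero, coeff_C_zero,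
      zero_add, add_sub_cancel_right]
    exact mul_comm _ _
  set Q : ℂ[X][X] := P - C (P.coeff 0) with hQ
  have hQmap (δ : A) : Q.map (evalRingHom δ.1) = h δ * ((F δ).divX.comp (h δ)) := by
    rw [← hFX, hQ, Polynomial.map_sub, hPmap, map_C, ← coeff_map, hPmap]
  have hmod : Q %ₘ H = 0 := by
    refine eq_zero_of_infinite_specialize hA fun δ hδ => ?_
    rw [map_modByMonic _ hH, hHh ⟨δ, hδ⟩, hQmap ⟨δ, hδ⟩,
      (modByMonic_eq_zero_iff_dvd (hh _))]
    exact dvd_mul_right _ _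
  obtain ⟨N, hN⟩ := (modByMonic_eq_zero_iff_dvd hH).1 hmod
  have hswapP : (Bivariate.swap Q).natDegree ≤ 1 := by
    have : Bivariate.swap Q = C (p - C (p.coeff 0)) + X * C (q - C (q.coeff 0)) := by
      simp [hQ, hPdef, coeff_map, Bivariate.swap_C, Bivariate.swap_map_C]
      ring
    rw [this]
    compute_degree
  have hQ0 : Q ≠ 0 := fun h0 => by
    have := congrArg natDegree h0
    rw [hQ, natDegree_sub_C, hPd, natDegree_zero] at this
    have := Nat.mul_ne_zero (by omega : k ≠ 0) hm
    omega
  obtain ⟨⟨δ, hδA⟩, ⟨δ', hδA'⟩, hne⟩ : ∃ δ δ' : A, δ ≠ δ' := by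
    have := hA.to_subtype
    exact exists_pair_ne A
  refine ⟨⟨δ, hδA⟩, ⟨δ', hδA'⟩, hne, ?_⟩
  have hcases : (Bivariate.swap H).natDegree = 0 ∨ (Bivariate.swap N).natDegree = 0 := by
    have hH0 : Bivariate.swap H ≠ 0 := by
      simpa using hH.ne_zero
    have hN0 : Bivariate.swap N ≠ 0 := by
      intro h0
      have : N = 0 := by simpa using h0
      exact hQ0 (by rw [hN, this, mul_zero])
    rw [hN, map_mul, natDegree_mul hH0 hN0] at hswapP
    omega
  have hmapC (a : ℂ[X]) (δ : ℂ) : (a.map C).map (evalRingHom δ) = a := by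
    have : (evalRingHom δ).comp C = RingHom.id ℂ := by ext; simp
    rw [Polynomial.map_map, this, Polynomial.map_id]
  rcases hcases with hc | hc
  · obtain ⟨a, ha⟩ := exists_map_C_of_natDegree_swap_eq_zero hc
    rw [← hHh, ← hHh, ha, hmapC, hmapC]
  · obtain ⟨b, hb⟩ := exists_map_C_of_natDegree_swap_eq_zero hc
    have hbδ (δ : A) : b = (F δ).divX.comp (h δ) := by
      have := hQmap δ
      rw [hN, Polynomial.map_mul, hHh, hb, hmapC] at this
      exact mul_left_cancel₀ (hh δ).ne_zero this
    have hG (δ : A) : (F δ).divX.natDegree = k - 1 := by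
      rw [natDegree_divX_eq_natDegree_tsub_one, hFk]
    have hGm (δ : A) : (F δ).divX.Monic := by
      rw [Monic, leadingCoeff, hG, coeff_divX, Nat.sub_add_cancel (by omega), ← hFk δ]
      exact hF δ
    have hGc (δ : A) : (b - h δ ^ (k - 1)).natDegree ≤ (k - 1 - 1) * m := by
      have := (hGm δ).natDegree_comp_sub_pow_le (h := h δ)
      rwa [← hbδ, hG, hhm] at this
    refine Monic.eq_of_natDegree_pow_sub_pow_le (k := k - 1) (by omega) (hh _) (hh _) (hhm _)
      (hhm _) (by rw [hh0, hh0]) ?_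
    have := natDegree_sub_le_of_le (hGc ⟨δ', hδA'⟩) (hGc ⟨δ, hδA⟩)
    rwa [max_self, sub_sub_sub_cancel_left] at this

end CommonFactor

section Fibers

theorem roots_sub_C_eq_val {P : ℂ[X]} {t : ℂ} {s : Finset ℂ} (hP : P.natDegree ≠ 0)
    (hs : s.card = P.natDegree) (h : ∀ z ∈ s, P.eval z = t) : (P - C t).roots = s.val := by
  have h0 : P - C t ≠ 0 := fun h0 => hP (by rw [← natDegree_sub_C (a := t), h0, natDegree_zero])
  refine (Multiset.eq_of_le_of_card_le ?_ ?_).symm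
  · rw [Multiset.le_iff_subset s.nodup]
    intro z hz
    rw [mem_roots h0, IsRoot.def, eval_sub, eval_C, h z hz, sub_self]
  · exact (card_roots' _).trans (by rw [natDegree_sub_C, ← hs, Finset.card_val])

theorem exists_mem_of_eval_eq {P : ℂ[X]} {t z : ℂ} {s : Finset ℂ} (hP : P.natDegree ≠ 0)
    (hs : s.card = P.natDegree) (h : ∀ z ∈ s, P.eval z = t) (hz : P.eval z = t) :
    z ∈ s ∧ P.derivative.eval z ≠ 0 := by
  have h0 : P - C t ≠ 0 := fun h0 => hP (by rw [← natDegree_sub_C (a := t), h0, natDegree_zero])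
  have hr := roots_sub_C_eq_val hP hs h
  have hroot : (P - C t).IsRoot z := by rw [IsRoot.def, eval_sub, eval_C, hz, sub_self]
  refine ⟨by rw [← Finset.mem_val, ← hr]; exact (mem_roots h0).2 hroot, fun hd => ?_⟩
  have := (one_lt_rootMultiplicity_iff_isRoot h0).2 ⟨hroot, by simpa using hd⟩
  rw [← count_roots, hr] at this
  exact absurd (Multiset.nodup_iff_count_le_one.1 s.nodup z) (by omega)

theorem exists_finset_fiber {P : ℂ[X]} {t : ℂ} (hP : P.natDegree ≠ 0)
    (h : ∀ w, P.eval w = t → P.derivative.eval w ≠ 0) :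
    ∃ s : Finset ℂ, s.card = P.natDegree ∧ ∀ z, z ∈ s ↔ P.eval z = t := by
  have h0 : P - C t ≠ 0 := fun h0 => hP (by rw [← natDegree_sub_C (a := t), h0, natDegree_zero])
  have hnd : (P - C t).roots.Nodup := by
    rw [Multiset.nodup_iff_count_le_one]
    intro z
    rw [count_roots]
    by_contra! hlt
    obtain ⟨h1, h2⟩ := (one_lt_rootMultiplicity_iff_isRoot h0).1 hlt
    rw [IsRoot.def, eval_sub, eval_C, sub_eq_zero] at h1
    exact h z h1 (by simpa using h2)
  refine ⟨⟨_, hnd⟩, ?_, fun z => ?_⟩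
  · rw [Finset.card_mk, ← (IsAlgClosed.splits (P - C t)).natDegree_eq_card_roots, natDegree_sub_C]
  · rw [Finset.mem_mk, mem_roots h0, IsRoot.def, eval_sub, eval_C, sub_eq_zero]

/-- A polynomial that is constant on sufficiently many simple fibers of `h` is a polynomial in
`h`. -/
theorem exists_eq_comp_of_constant_on_fibers {h : ℂ[X]} (hh : h.natDegree ≠ 0) {P : ℂ[X]}
    {A : Set ℂ} (hA : A.Infinite)
    (H : ∀ c ∈ A, ∃ s : Finset ℂ, s.card = h.natDegree ∧ (∀ z ∈ s, h.eval z = c) ∧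
      ∃ t, ∀ z ∈ s, P.eval z = t) : ∃ F : ℂ[X], P = F.comp h := by
  induction hn : P.natDegree using Nat.strong_induction_on generalizing P A with
  | _ n ih =>
  subst hn
  obtain ⟨c, hc⟩ := hA.nonempty
  obtain ⟨s, hs, hsc, t, ht⟩ := H c hc
  by_cases hPt : P - C t = 0
  · exact ⟨C t, by rw [C_comp]; exact sub_eq_zero.1 hPt⟩
  have hdvd : h - C c ∣ P - C t := by
    refine (IsAlgClosed.splits (h - C c)).dvd_of_roots_le_roots ?_ ?_
    · exact fun h0 => hh (by rw [← natDegree_sub_C (a := c), h0, natDegree_zero])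
    rw [roots_sub_C_eq_val hh hs hsc, Multiset.le_iff_subset s.nodup]
    intro z hz
    rw [mem_roots hPt, IsRoot.def, eval_sub, eval_C, ht z hz, sub_self]
  obtain ⟨q, hq⟩ := hdvd
  have hhc : h - C c ≠ 0 := fun h0 => hPt (by rw [hq, h0, zero_mul])
  have hq0 : q ≠ 0 := fun h0 => hPt (by rw [hq, h0, mul_zero])
  have hdeg : P.natDegree = h.natDegree + q.natDegree := by
    rw [← natDegree_sub_C (a := t), hq, natDegree_mul hhc hq0, natDegree_sub_C]
  obtain ⟨F, hF⟩ := ih q.natDegree (by omega) (hA.sdiff (Set.finite_singleton c))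
    (fun c' hc' => by
      obtain ⟨s', hs', hsc', t', ht'⟩ := H c' hc'.1
      refine ⟨s', hs', hsc', (t' - t) / (c' - c), fun z hz => ?_⟩
      have := congrArg (eval z) hq
      rw [eval_mul, eval_sub, eval_sub, eval_C, eval_C, ht' z hz, hsc' z hz] at this
      rw [this, mul_div_cancel_left₀ _ (sub_ne_zero.2 hc'.2)]) rfl
  refine ⟨(X - C c) * F + C t, ?_⟩
  rw [add_comp, mul_comp, sub_comp, X_comp, C_comp, C_comp, ← hF, ← hq, sub_add_cancel]

/-- Points in a common fiber of a nonconstant polynomial have comparable norms. -/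
theorem exists_norm_le_of_eval_eq {P : ℂ[X]} (hP : P.natDegree ≠ 0) :
    ∃ K : ℝ, 1 ≤ K ∧ ∀ z w : ℂ, P.eval w = P.eval z → ‖w‖ ≤ K * max 1 ‖z‖ := by
  obtain ⟨n, hn⟩ := Nat.exists_eq_succ_of_ne_zero hP
  set a := P.leadingCoeff with ha
  have ha0 : 0 < ‖a‖ := norm_pos_iff.2 (leadingCoeff_ne_zero.2 fun h => hP (by simp [h]))
  set S := ∑ i ∈ Finset.range (n + 2), ‖P.coeff i‖ with hS
  have hS0 : 0 ≤ S := Finset.sum_nonneg fun _ _ => norm_nonneg _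
  refine ⟨max 1 (2 * S / ‖a‖), le_max_left _ _, fun z w hzw => ?_⟩
  set M := max 1 ‖z‖ with hM
  have hM1 : 1 ≤ M := le_max_left _ _
  rcases le_or_gt ‖w‖ M with hwM | hwM
  · exact hwM.trans (le_mul_of_one_le_left (by linarith) (le_max_left _ _))
  have hw1 : 1 ≤ ‖w‖ := hM1.trans hwM.le
  have hz : ‖P.eval z‖ ≤ S * M ^ (n + 1) := by
    rw [eval_eq_sum_range, hn, hS, Finset.sum_mul]
    refine (norm_sum_le _ _).trans (Finset.sum_le_sum fun i hi => ?_)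
    rw [norm_mul, norm_pow]
    refine mul_le_mul_of_nonneg_left ?_ (norm_nonneg _)
    exact (pow_le_pow_left₀ (norm_nonneg _) (le_max_right _ _) i).trans
      (pow_le_pow_right₀ hM1 (by have := Finset.mem_range.1 hi; omega))
  have hw : ‖a‖ * ‖w‖ ^ (n + 1) ≤ ‖P.eval w‖ + S * ‖w‖ ^ n := by
    have e : a * w ^ (n + 1) = P.eval w - ∑ i ∈ Finset.range (n + 1), P.coeff i * w ^ i := by
      rw [eval_eq_sum_range, hn, Finset.sum_range_succ _ (n + 1), ha, leadingCoeff, hn]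
      ring
    rw [← norm_pow, ← norm_mul, e]
    refine (norm_sub_le _ _).trans (add_le_add le_rfl ((norm_sum_le _ _).trans ?_))
    rw [hS, Finset.sum_mul]
    refine le_trans (Finset.sum_le_sum fun i hi => ?_) (Finset.sum_le_sum_of_subset_of_nonneg
      (Finset.range_subset_range.2 (Nat.le_succ (n + 1))) fun i _ _ => by positivity)
    rw [norm_mul, norm_pow]
    exact mul_le_mul_of_nonneg_left (pow_le_pow_right₀ hw1
      (by have := Finset.mem_range.1 hi; omega)) (norm_nonneg _)
  have hMw : S * M ^ (n + 1) ≤ S * M * ‖w‖ ^ n := by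
    rw [mul_assoc, pow_succ']
    gcongr
  have hSw : S * ‖w‖ ^ n ≤ S * M * ‖w‖ ^ n := by
    gcongr
    exact le_mul_of_one_le_right hS0 hM1
  have hfin : ‖a‖ * ‖w‖ ≤ 2 * S * M := by
    refine le_of_mul_le_mul_right ?_ (pow_pos (by linarith : 0 < ‖w‖) n)
    rw [hzw] at hw
    calc ‖a‖ * ‖w‖ * ‖w‖ ^ n = ‖a‖ * ‖w‖ ^ (n + 1) := by ring
      _ ≤ 2 * S * M * ‖w‖ ^ n := by linarith
  calc ‖w‖ ≤ 2 * S / ‖a‖ * M := by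
        rw [div_mul_eq_mul_div, le_div_iff₀ ha0]
        linarith
    _ ≤ _ := mul_le_mul_of_nonneg_right (le_max_right _ _) (by linarith)

end Fibers

section Entire

/-- A bounded holomorphic function on the complement of a finite set extends to the plane. -/
theorem exists_differentiable_extension {u : ℂ → ℂ} {S : Set ℂ} (hS : S.Finite)
    (hu : ∀ z ∉ S, DifferentiableAt ℂ u z) {b : ℂ → ℝ} (hb : Continuous b)
    (hub : ∀ z ∉ S, ‖u z‖ ≤ b z) :
    ∃ v : ℂ → ℂ, Differentiable ℂ v ∧ ∀ z ∉ S, v z = u z := by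
  induction S, hS using Set.Finite.induction_on generalizing u b with
  | empty => exact ⟨u, fun z => hu z (Set.notMem_empty z), fun _ _ => rfl⟩
  | @insert a S ha hS ih =>
    set u' := Function.update u a ((nhdsWithin a {a}ᶜ).limUnder u) with hu'
    have hne {z : ℂ} (hz : z ≠ a) : u' z = u z := Function.update_of_ne hz _ _
    obtain ⟨r, hr, hrS⟩ : ∃ r > 0, Metric.ball a r ⊆ Sᶜ :=
      Metric.isOpen_iff.1 hS.isClosed.isOpen_compl a ha
    have hball : ∀ z ∈ Metric.ball a r \ {a}, z ∉ insert a S := by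
      rintro z ⟨hz, hza⟩ (h | h)
      · exact hza h
      · exact hrS hz h
    have hd : DifferentiableOn ℂ u' (Metric.ball a r) := by
      refine Complex.differentiableOn_update_limUnder_of_bddAbove (Metric.ball_mem_nhds a hr)
        (fun z hz => (hu z (hball z hz)).differentiableWithinAt) ?_
      obtain ⟨K, hK⟩ := (isCompact_closedBall a r).bddAbove_image hb.continuousOn
      refine ⟨K, ?_⟩
      rintro _ ⟨z, hz, rfl⟩
      exact (hub z (hball z hz)).trans (hK ⟨z, Metric.ball_subset_closedBall hz.1, rfl⟩)
    have hd' : ∀ z ∉ S, DifferentiableAt ℂ u' z := by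
      intro z hz
      by_cases hza : z = a
      · subst hza
        exact hd.differentiableAt (Metric.ball_mem_nhds z hr)
      · refine (hu z (by simp [hza, hz])).congr_of_eventuallyEq ?_
        filter_upwards [isOpen_ne.mem_nhds hza] with y hy using hne hy
    have hub' : ∀ z ∉ S, ‖u' z‖ ≤ max (b z) ‖u' a‖ := by
      intro z hz
      by_cases hza : z = a
      · subst hza
        exact le_max_right _ _
      · rw [hne hza]
        exact (hub z (by simp [hza, hz])).trans (le_max_left _ _)
    obtain ⟨v, hv, hvu⟩ := ih hd' (b := fun z => max (b z) ‖u' a‖) (by fun_prop) hub'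
    refine ⟨v, hv, fun z hz => ?_⟩
    rw [Set.mem_insert_iff, not_or] at hz
    rw [hvu z hz.2, hne hz.1]

/-- An entire function of polynomial growth is a polynomial. -/
theorem exists_polynomial_of_growth {u : ℂ → ℂ} (hu : Differentiable ℂ u) {K : ℝ} {m : ℕ}
    (h : ∀ z, ‖u z‖ ≤ K * max 1 ‖z‖ ^ m) :
    ∃ p : ℂ[X], p.natDegree ≤ m ∧ ∀ z, p.eval z = u z := by
  have hder : ∀ k, m < k → iteratedDeriv k u 0 = 0 := by
    intro k hk
    have hbound : ∀ R : ℝ, 1 ≤ R → ‖iteratedDeriv k u 0‖ ≤ k.factorial * |K| * R⁻¹ := by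
      intro R hR
      have hR0 : 0 < R := by linarith
      refine (Complex.norm_iteratedDeriv_le_of_forall_mem_sphere_norm_le (C := |K| * R ^ m) k hR0
        hu.diffContOnCl fun z hz => ?_).trans ?_
      · have : ‖z‖ = R := by simpa using hz
        refine (h z).trans ?_
        rw [this, max_eq_right hR]
        gcongr
        exact le_abs_self K
      · rw [mul_assoc, mul_div_assoc, mul_div_assoc]
        gcongr
        rw [div_le_iff₀ (by positivity), inv_mul_eq_div, le_div_iff₀ hR0, ← pow_succ]
        exact pow_le_pow_right₀ hR hk
    have hlim : Filter.Tendsto (fun R : ℝ => k.factorial * |K| * R⁻¹) Filter.atTop (nhds 0) := by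
      simpa using tendsto_inv_atTop_zero.const_mul (k.factorial * |K|)
    refine norm_le_zero_iff.1 (ge_of_tendsto hlim ?_)
    filter_upwards [Filter.eventually_ge_atTop 1] with R hR using hbound R hR
  refine ⟨∑ k ∈ Finset.range (m + 1), C ((k.factorial : ℂ)⁻¹ * iteratedDeriv k u 0) * X ^ k,
    natDegree_sum_le_of_forall_le _ _ fun k hk =>
      (natDegree_C_mul_X_pow_le _ _).trans (by have := Finset.mem_range.1 hk; omega),
    fun z => ?_⟩
  rw [← Complex.taylorSeries_eq_of_entire' 0 z hu, tsum_eq_sum (s := Finset.range (m + 1)),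
    eval_finsetSum]
  · simp
  · intro k hk
    rw [hder k (by simpa using hk)]
    simp

end Entire

section Pencil

/-- The polynomial `f + ε g`. -/
def pencil (f g : ℂ[X]) (ε : ℂ) : ℂ[X] := f + C ε * g

theorem eval_pencil (f g : ℂ[X]) (ε z : ℂ) :
    (pencil f g ε).eval z = f.eval z + ε * g.eval z := by
  simp [pencil]

theorem natDegree_pencil {f g : ℂ[X]} {ε : ℂ} (h : leadC f g ε ≠ 0) :
    (pencil f g ε).natDegree = defDeg f g := by
  refine natDegree_eq_of_le_of_coeff_ne_zero ?_ (by simpa [pencil, leadC] using h)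
  exact natDegree_add_le_of_degree_le (le_max_left _ _)
    ((natDegree_C_mul_le _ _).trans (le_max_right _ _))

/-- If infinitely many members of a pencil are compositions with inner factors of a fixed degree,
then the generators have a common composition factor of this degree. -/
theorem exists_common_comp_of_infinite {f g : ℂ[X]} {m : ℕ} {A : Set ℂ} (hA : A.Infinite)
    (hm : m ≠ 0) (hmn : m < defDeg f g) (hlead : ∀ ε ∈ A, leadC f g ε ≠ 0)
    (h : ∀ ε ∈ A, ∃ F h : ℂ[X], h.natDegree = m ∧ pencil f g ε = F.comp h) :
    ∃ F₀ F₁ h : ℂ[X], h.natDegree = m ∧ f = F₀.comp h ∧ g = F₁.comp h := by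
  set n := defDeg f g with hn
  have hfn : f.natDegree ≤ n := le_max_left _ _
  have hgn : g.natDegree ≤ n := le_max_right _ _
  have hmonic {p : ℂ[X]} (hp : p.natDegree ≤ n) (hc : p.coeff n ≠ 0) :
      (C (p.coeff n)⁻¹ * p).Monic ∧ (C (p.coeff n)⁻¹ * p).natDegree = n := by
    have hd : p.natDegree = n := natDegree_eq_of_le_of_coeff_ne_zero hp hc
    refine ⟨?_, by rw [natDegree_C_mul (inv_ne_zero hc), hd]⟩
    rw [Monic, leadingCoeff, natDegree_C_mul (inv_ne_zero hc), hd, coeff_C_mul,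
      inv_mul_cancel₀ hc]
  have hdeglt {p q : ℂ[X]} (hp : p.Monic ∧ p.natDegree = n) (hq : q.natDegree ≤ n)
      (hc : q.coeff n = 0) : q.degree < p.degree := by
    rw [degree_eq_natDegree hp.1.ne_zero, hp.2, degree_lt_iff_coeff_zero]
    intro k hk
    rcases hk.eq_or_lt with rfl | hlt
    · exact hc
    · exact coeff_eq_zero_of_natDegree_lt (hq.trans_lt hlt)
  by_cases hg : g.coeff n = 0
  · have hf : f.coeff n ≠ 0 := by
      obtain ⟨ε, hε⟩ := hA.nonempty
      intro hf
      exact hlead ε hε (by rw [leadC, ← hn, hf, hg, mul_zero, zero_add])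
    set c := f.coeff n with hc
    have hp := hmonic hfn hf
    have hq : (C c⁻¹ * g).degree < (C c⁻¹ * f).degree :=
      hdeglt hp ((natDegree_C_mul_le _ _).trans hgn) (by rw [coeff_C_mul, hg, mul_zero])
    obtain ⟨F₀, F₁, k, hk, h0, h1⟩ := exists_common_comp_of_infinite_monic hA hp.1 hq hm
      (by rw [hp.2]; exact hmn) fun ε hε => by
        obtain ⟨F, k, hk, hF⟩ := h ε hε
        refine ⟨C c⁻¹ * F, k, hk, ?_⟩
        rw [mul_comp, C_comp, ← hF, pencil]
        ring
    refine ⟨C c * F₀, C c * F₁, k, hk, ?_, ?_⟩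
    · rw [mul_comp, C_comp, ← h0, ← mul_assoc, ← C_mul, mul_inv_cancel₀ hf, C_1, one_mul]
    · rw [mul_comp, C_comp, ← h1, ← mul_assoc, ← C_mul, mul_inv_cancel₀ hf, C_1, one_mul]
  · set c := g.coeff n with hc
    set p := C c⁻¹ * g with hp_def
    set q := f - C (f.coeff n) * p with hq_def
    have hp := hmonic hgn hg
    have hpn : p.coeff n = 1 := by rw [hp_def, coeff_C_mul, inv_mul_cancel₀ hg]
    have hq : q.degree < p.degree :=
      hdeglt hp ((natDegree_sub_le_of_le hfn ((natDegree_C_mul_le _ _).trans hp.2.le)).trans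
        (max_self n).le) (by rw [hq_def, coeff_sub, coeff_C_mul, hpn, mul_one, sub_self])
    have hgp : g = C c * p := by
      rw [hp_def, ← mul_assoc, ← C_mul, mul_inv_cancel₀ hg, C_1, one_mul]
    have hpencil (ε : ℂ) : pencil f g ε = C (leadC f g ε) * p + q := by
      rw [pencil, leadC, ← hn, ← hc, C_add, C_mul, hq_def]
      nth_rw 1 [hgp]
      ring
    have hinj : Set.InjOn (fun ε => (leadC f g ε)⁻¹) A := by
      intro ε _ ε' _ hεε
      have := inv_injective hεε
      rw [leadC, leadC, ← hn, ← hc, add_right_inj] at this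
      exact mul_right_cancel₀ hg this
    obtain ⟨F₀, F₁, k, hk, h0, h1⟩ := exists_common_comp_of_infinite_monic (hA.image hinj)
      hp.1 hq hm (by rw [hp.2]; exact hmn) (by
        rintro _ ⟨ε, hε, rfl⟩
        obtain ⟨F, k, hk, hF⟩ := h ε hε
        refine ⟨C (leadC f g ε)⁻¹ * F, k, hk, ?_⟩
        rw [mul_comp, C_comp, ← hF, hpencil, mul_add, ← mul_assoc, ← C_mul,
          inv_mul_cancel₀ (hlead ε hε), C_1, one_mul])
    refine ⟨F₁ + C (f.coeff n) * F₀, C c * F₀, k, hk, ?_, ?_⟩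
    · rw [add_comp, mul_comp, C_comp, ← h0, ← h1, hq_def, sub_add_cancel]
    · rw [mul_comp, C_comp, ← h0, ← hgp]

end Pencil

section Frames

/-- The labelings of the simple fibers of the members of the pencil by the elements of `ι`. -/
def frames (ι : Type*) (f g : ℂ[X]) : Set ((ι → ℂ) × ℂ) :=
  {x | leadC f g x.2 ≠ 0 ∧ Function.Injective x.1 ∧
    ∀ b c, (pencil f g x.2).eval (x.1 b) = (pencil f g x.2).eval (x.1 c)}

/-- Simple roots of the equation `f(z) + ε g(z) = t` depend holomorphically on `(t, ε)`. -/
theorem exists_local_root {f g : ℂ[X]} {ε₀ w : ℂ}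
    (hw : (pencil f g ε₀).derivative.eval w ≠ 0) :
    ∃ ψ : ℂ × ℂ → ℂ, ψ ((pencil f g ε₀).eval w, ε₀) = w ∧
      (∀ᶠ u in nhds ((pencil f g ε₀).eval w, ε₀),
        DifferentiableAt ℂ ψ u ∧ (pencil f g u.2).eval (ψ u) = u.1) ∧
      ∀ᶠ x in nhds (w, ε₀), ψ ((pencil f g x.2).eval x.1, x.2) = x.1 := by
  set H : ℂ × ℂ → ℂ × ℂ := fun x => ((pencil f g x.2).eval x.1, x.2) with hH
  have hH' : H = fun x => (f.eval x.1 + x.2 * g.eval x.1, x.2) := by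
    funext x
    simp only [hH, eval_pencil]
  set d := (pencil f g ε₀).derivative.eval w with hd
  have hd' : d = f.derivative.eval w + ε₀ * g.derivative.eval w := by simp [hd, pencil]
  let L : (ℂ × ℂ) ≃L[ℂ] (ℂ × ℂ) := LinearEquiv.toContinuousLinearEquiv
    { toFun := fun x => (d * x.1 + g.eval w * x.2, x.2)
      map_add' := fun x y => by ext <;> simp; ring
      map_smul' := fun c x => by ext <;> simp; ring
      invFun := fun x => (d⁻¹ * (x.1 - g.eval w * x.2), x.2)
      left_inv := fun x => by ext <;> simp [hw]
      right_inv := fun x => by ext <;> simp [hw] }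
  have hcd : ContDiff ℂ 1 H := by
    have hp (p : ℂ[X]) : ContDiff ℂ 1 fun x : ℂ × ℂ => p.eval x.1 := by
      have h : ContDiff ℂ 1 fun z : ℂ => p.eval z := by
        simpa only [coe_aeval_eq_eval] using p.contDiff_aeval (𝕜 := ℂ) 1
      exact h.comp contDiff_fst
    rw [hH']
    exact ((hp f).add (contDiff_snd.mul (hp g))).prodMk contDiff_snd
  have hfd : HasFDerivAt H (L : (ℂ × ℂ) →L[ℂ] (ℂ × ℂ)) (w, ε₀) := by
    have hp (p : ℂ[X]) : HasFDerivAt (fun x : ℂ × ℂ => p.eval x.1)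
        (p.derivative.eval w • ContinuousLinearMap.fst ℂ ℂ ℂ) (w, ε₀) :=
      HasDerivAt.comp_hasFDerivAt (h₂ := fun z => p.eval z) (f := Prod.fst) (w, ε₀)
        (p.hasDerivAt w) hasFDerivAt_fst
    rw [hH']
    refine (((hp f).add (hasFDerivAt_snd.mul (hp g))).prodMk hasFDerivAt_snd).congr_fderiv ?_
    ext <;> simp [L, hd']
  have hs := hcd.contDiffAt.hasStrictFDerivAt' hfd one_ne_zero
  have hinv : ContDiffAt ℂ 1 (hs.localInverse H L (w, ε₀)) (H (w, ε₀)) :=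
    hcd.contDiffAt.to_localInverse hfd one_ne_zero
  refine ⟨fun u => (hs.localInverse H L (w, ε₀) u).1, ?_, ?_, ?_⟩
  · exact congrArg Prod.fst hs.localInverse_apply_image
  · filter_upwards [hs.eventually_right_inverse, hinv.eventually (by simp)] with u hu hu'
    refine ⟨(hu'.differentiableAt one_ne_zero).fst, ?_⟩
    have h2 := congrArg Prod.snd hu
    have h1 := congrArg Prod.fst hu
    simp only [hH] at h1 h2
    rwa [h2] at h1
  · filter_upwards [hs.eventually_left_inverse] with x hx using congrArg Prod.fst hx

theorem JoinedIn.frames_comp {ι : Type*} {f g : ℂ[X]} {v v' : ι → ℂ} {ε ε' : ℂ}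
    (h : JoinedIn (frames ι f g) (v, ε) (v', ε')) (π : Equiv.Perm ι) :
    JoinedIn (frames ι f g) (v ∘ π, ε) (v' ∘ π, ε') := by
  refine (h.map (f := fun x : (ι → ℂ) × ℂ => (x.1 ∘ π, x.2)) (by fun_prop)).mono ?_
  rintro _ ⟨x, hx, rfl⟩
  exact ⟨hx.1, hx.2.1.comp π.injective, fun b c => hx.2.2 _ _⟩

theorem continuous_leadC (f g : ℂ[X]) : Continuous (leadC f g) := by
  unfold leadC
  fun_prop

variable {ι : Type*} [Fintype ι] {f g : ℂ[X]}

theorem mem_range_of_mem_frames (hn : defDeg f g ≠ 0) (hι : Fintype.card ι = defDeg f g)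
    {x : (ι → ℂ) × ℂ} (hx : x ∈ frames ι f g) {b : ι} {z : ℂ}
    (hz : (pencil f g x.2).eval z = (pencil f g x.2).eval (x.1 b)) :
    z ∈ Set.range x.1 ∧ (pencil f g x.2).derivative.eval z ≠ 0 := by
  classical
  have hd := natDegree_pencil hx.1
  have := exists_mem_of_eval_eq (P := pencil f g x.2) (s := Finset.univ.image x.1)
    (by rwa [hd]) (by rw [Finset.card_image_of_injective _ hx.2.1, hd, ← hι, Finset.card_univ])
    (by simpa using fun c => hx.2.2 c b) hz
  simpa using this

theorem exists_perm_of_mem_frames (hn : defDeg f g ≠ 0) (hι : Fintype.card ι = defDeg f g)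
    {v v' : ι → ℂ} {ε : ℂ} (hv : (v, ε) ∈ frames ι f g) (hv' : (v', ε) ∈ frames ι f g) {b c : ι}
    (hbc : v b = v' c) : ∃ π : Equiv.Perm ι, v' = v ∘ π := by
  have h (a : ι) : ∃ a', v a' = v' a :=
    (mem_range_of_mem_frames hn hι hv (b := b) (z := v' a)
      (by rw [hv'.2.2 a c]; exact congrArg (fun z => (pencil f g ε).eval z) hbc.symm)).1
  choose π hπ using h
  have hinj : Function.Injective π := fun a a' haa => hv'.2.1 (by
    change v' a = v' a'
    rw [← hπ a, ← hπ a', haa])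
  exact ⟨Equiv.ofBijective π (Finite.injective_iff_bijective.1 hinj), funext fun a => (hπ a).symm⟩

theorem exists_local_frame (hn : defDeg f g ≠ 0) (hι : Fintype.card ι = defDeg f g)
    {v : ι → ℂ} {ε t : ℂ} (hv : (v, ε) ∈ frames ι f g)
    (ht : ∀ b, (pencil f g ε).eval (v b) = t) :
    ∃ Φ : ℂ × ℂ → ι → ℂ,
      (∀ᶠ u in nhds (t, ε), DifferentiableAt ℂ Φ u ∧
        JoinedIn (frames ι f g) (v, ε) (Φ u, u.2)) ∧
      ∀ b, ∀ᶠ x in nhds (v b, ε), Φ ((pencil f g x.2).eval x.1, x.2) b = x.1 := by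
  have hroot (b : ι) := exists_local_root (mem_range_of_mem_frames hn hι hv (b := b) rfl).2
  choose ψ hψ₀ hψ hψ' using hroot
  simp only [ht] at hψ₀ hψ
  set Φ : ℂ × ℂ → ι → ℂ := fun u b => ψ b u with hΦ
  have hΦ₀ : Φ (t, ε) = v := funext hψ₀
  have hall : ∀ᶠ u in nhds (t, ε), ∀ b, DifferentiableAt ℂ (ψ b) u ∧
      (pencil f g u.2).eval (ψ b u) = u.1 := Filter.eventually_all.2 hψ
  have hinj : ∀ᶠ u in nhds (t, ε), Function.Injective (Φ u) := by
    have h (p : ι × ι) (hp : p.1 ≠ p.2) : ∀ᶠ u in nhds (t, ε), ψ p.1 u ≠ ψ p.2 u := by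
      have hc (b : ι) : ContinuousAt (ψ b) (t, ε) := (hψ b).self_of_nhds.1.continuousAt
      refine ((hc p.1).prodMk (hc p.2)).eventually (isOpen_ne_fun continuous_fst continuous_snd
        |>.mem_nhds ?_)
      change ψ p.1 (t, ε) ≠ ψ p.2 (t, ε)
      rw [hψ₀, hψ₀]
      exact hv.2.1.ne hp
    have h' : ∀ᶠ u in nhds (t, ε), ∀ p : ι × ι, p.1 ≠ p.2 → ψ p.1 u ≠ ψ p.2 u := by
      refine Filter.eventually_all.2 fun p => ?_
      by_cases hp : p.1 = p.2
      · exact Filter.Eventually.of_forall fun u hne => absurd hp hne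
      · filter_upwards [h p hp] with u hu using fun _ => hu
    filter_upwards [h'] with u hu b c hbc
    by_contra hne
    exact hu (b, c) hne hbc
  have hlead : ∀ᶠ u : ℂ × ℂ in nhds (t, ε), leadC f g u.2 ≠ 0 :=
    ((continuous_leadC f g).comp continuous_snd).continuousAt.eventually_ne hv.1
  have hgood := (hall.and hinj).and hlead
  obtain ⟨r, hr, hball⟩ := Metric.eventually_nhds_iff_ball.1 hgood
  refine ⟨Φ, ?_, hψ'⟩
  filter_upwards [Metric.ball_mem_nhds (t, ε) hr] with u hu
  have hdiff : ∀ u ∈ Metric.ball (t, ε) r, DifferentiableAt ℂ Φ u := fun u hu =>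
    differentiableAt_pi.2 fun b => ((hball u hu).1.1 b).1
  refine ⟨hdiff u hu, ?_⟩
  have hj : JoinedIn (Metric.ball (t, ε) r) (t, ε) u :=
    ((convex_ball (t, ε) r).isPathConnected ⟨_, hu⟩).joinedIn _ (Metric.mem_ball_self hr) _ hu
  have hj' := hj.map_continuousOn (f := fun u => (Φ u, u.2))
    fun u hu => ((hdiff u hu).continuousAt.prodMk continuousAt_snd).continuousWithinAt
  simp only [hΦ₀] at hj'
  refine hj'.mono ?_
  rintro _ ⟨y, hy, rfl⟩
  obtain ⟨⟨h1, h2⟩, h3⟩ := hball y hy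
  exact ⟨h3, h2, fun b c => (h1 b).2.trans (h1 c).2.symm⟩

theorem exists_slice_frame (hn : defDeg f g ≠ 0) (hι : Fintype.card ι = defDeg f g)
    {v : ι → ℂ} {ε : ℂ} (hv : (v, ε) ∈ frames ι f g) (b₀ : ι) :
    ∃ φ : ℂ → ι → ℂ, ∀ᶠ z in nhds (v b₀), DifferentiableAt ℂ φ z ∧
      JoinedIn (frames ι f g) (v, ε) (φ z, ε) ∧ φ z b₀ = z := by
  obtain ⟨Φ, hΦ, hΦ'⟩ := exists_local_frame hn hι hv (fun b => hv.2.2 b b₀)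
  have hd (z : ℂ) : DifferentiableAt ℂ (fun z => ((pencil f g ε).eval z, ε)) z := by fun_prop
  refine ⟨fun z => Φ ((pencil f g ε).eval z, ε), ?_⟩
  have h1 := (hd (v b₀)).continuousAt.eventually hΦ
  have h2 : ∀ᶠ z in nhds (v b₀), Φ ((pencil f g ε).eval z, ε) b₀ = z :=
    (Continuous.prodMk_left ε).continuousAt.eventually (hΦ' b₀)
  filter_upwards [h1, h2] with z hz1 hz2
  exact ⟨DifferentiableAt.comp z hz1.1 (hd z), hz1.2, hz2⟩

theorem eventually_exists_joinedIn_frames [Nonempty ι] (hn : defDeg f g ≠ 0)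
    (hι : Fintype.card ι = defDeg f g) {v : ι → ℂ} {ε₀ : ℂ} (hv : (v, ε₀) ∈ frames ι f g) :
    ∀ᶠ ε in nhds ε₀, ∃ v', JoinedIn (frames ι f g) (v, ε₀) (v', ε) := by
  obtain ⟨b₀⟩ := ‹Nonempty ι›
  obtain ⟨Φ, hΦ, -⟩ := exists_local_frame hn hι hv (fun b => hv.2.2 b b₀)
  have h := (Continuous.prodMk_right ((pencil f g ε₀).eval (v b₀))).continuousAt.eventually hΦ
  filter_upwards [h] with ε hε using ⟨_, hε.2⟩

theorem finite_not_mem_frames (hn : defDeg f g ≠ 0) (hι : Fintype.card ι = defDeg f g) {ε : ℂ}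
    (hε : leadC f g ε ≠ 0) (b₀ : ι) :
    {z | ∃ v, (v, ε) ∈ frames ι f g ∧ v b₀ = z}ᶜ.Finite := by
  classical
  set P := pencil f g ε with hP
  have hPn : P.natDegree = defDeg f g := natDegree_pencil hε
  have hP0 : P.natDegree ≠ 0 := hPn.trans_ne hn
  have hfib (t : ℂ) : (P.eval ⁻¹' {t}).Finite := by
    have h0 : P - C t ≠ 0 := fun h0 => hP0 (by
      rw [← natDegree_sub_C (a := t), h0, natDegree_zero])
    refine (P - C t).roots.toFinset.finite_toSet.subset fun z hz => ?_
    simpa [h0, sub_eq_zero] using hz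
  have hcrit : {w | P.derivative.eval w = 0}.Finite := by
    have h0 : P.derivative ≠ 0 := fun h0 => hP0 (derivative_eq_zero.1 h0)
    refine P.derivative.roots.toFinset.finite_toSet.subset fun z hz => ?_
    simpa [h0] using hz
  refine ((hcrit.image P.eval).preimage' fun t _ => hfib t).subset fun z hz => ?_
  by_contra hzc
  apply hz
  obtain ⟨s, hs, hsz⟩ := exists_finset_fiber (P := P) (t := P.eval z) hP0
    fun w hw hw' => hzc ⟨w, hw', hw⟩
  have e : ι ≃ s := Fintype.equivOfCardEq (by rw [hι, Fintype.card_coe, hs, hPn])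
  set π := Equiv.swap b₀ (e.symm ⟨z, (hsz z).2 rfl⟩) with hπ
  refine ⟨fun b => (e (π b)).1, ⟨hε, ?_, fun b c => ?_⟩, ?_⟩
  · exact Subtype.val_injective.comp (e.injective.comp π.injective)
  · exact ((hsz _).1 (e (π b)).2).trans ((hsz _).1 (e (π c)).2).symm
  · simp [hπ]

/-- Every simple point of a slice is reached by continuing a fixed label. -/
theorem exists_joinedIn_frames_apply_eq (hn : defDeg f g ≠ 0) (hι : Fintype.card ι = defDeg f g)
    {x₀ : (ι → ℂ) × ℂ} {v₁ v : ι → ℂ} {ε : ℂ} (h₁ : JoinedIn (frames ι f g) x₀ (v₁, ε)) (b₀ : ι)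
    (hv : (v, ε) ∈ frames ι f g) :
    ∃ v', JoinedIn (frames ι f g) x₀ (v', ε) ∧ v' b₀ = v b₀ := by
  set E := {z | ∃ v, (v, ε) ∈ frames ι f g ∧ v b₀ = z} with hE
  set S := {z | ∃ v, JoinedIn (frames ι f g) x₀ (v, ε) ∧ v b₀ = z} with hS
  have hEconn : IsPreconnected E := by
    have := ((finite_not_mem_frames hn hι h₁.target_mem.1 b₀).countable
      |>.isPathConnected_compl_of_one_lt_rank
        (by rw [Complex.rank_real_complex]; exact Cardinal.one_lt_two))
    rw [compl_compl] at this
    exact this.isConnected.isPreconnected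
  have hSo : IsOpen S := by
    rw [isOpen_iff_eventually]
    rintro _ ⟨v, hv, rfl⟩
    obtain ⟨φ, hφ⟩ := exists_slice_frame hn hι hv.target_mem b₀
    filter_upwards [hφ] with z hz using ⟨φ z, hv.trans hz.2.1, hz.2.2⟩
  have hTo : IsOpen (E \ S) := by
    rw [isOpen_iff_eventually]
    rintro _ ⟨⟨v, hv, rfl⟩, hvS⟩
    obtain ⟨φ, hφ⟩ := exists_slice_frame hn hι hv b₀
    filter_upwards [hφ] with z hz
    refine ⟨⟨φ z, hz.2.1.target_mem, hz.2.2⟩, ?_⟩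
    rintro ⟨v', hv', hv'z⟩
    obtain ⟨π, rfl⟩ := exists_perm_of_mem_frames hn hι hz.2.1.target_mem hv'.target_mem
      (b := b₀) (c := b₀) (by rw [hz.2.2, hv'z])
    have hπ : π b₀ = b₀ := hz.2.1.target_mem.2.1 (hv'z.trans hz.2.2.symm)
    exact hvS ⟨v ∘ π, hv'.trans (hz.2.1.frames_comp π).symm, by simp [hπ]⟩
  have hsub : E ⊆ S := hEconn.subset_left_of_subset_union hSo hTo
    (Set.disjoint_left.2 fun z hz hz' => hz'.2 hz)
    (fun z hz => by by_cases h : z ∈ S <;> simp [h, hz])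
    ⟨v₁ b₀, ⟨v₁, h₁.target_mem, rfl⟩, ⟨v₁, h₁, rfl⟩⟩
  exact hsub ⟨v, hv, rfl⟩

end Frames

section Monodromy

variable {f g : ℂ[X]} {t₀ ε₀ : ℂ}

theorem isMonodromyPerm_of_joinedIn_frames [Fintype (theFiber f g t₀ ε₀)] (hn : defDeg f g ≠ 0)
    (hι : Fintype.card (theFiber f g t₀ ε₀) = defDeg f g)
    {σ : Equiv.Perm (theFiber f g t₀ ε₀)}
    (h : JoinedIn (frames (theFiber f g t₀ ε₀) f g) (Subtype.val, ε₀) (Subtype.val ∘ σ, ε₀)) :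
    IsMonodromyPerm f g t₀ ε₀ σ := by
  obtain ⟨b₀⟩ : Nonempty (theFiber f g t₀ ε₀) := Fintype.card_pos_iff.1 (by omega)
  set p := h.somePath.extend with hp
  have hpc : Continuous p := h.somePath.continuous_extend
  have hp0 : p 0 = (Subtype.val, ε₀) := h.somePath.extend_zero
  have hp1 : p 1 = (Subtype.val ∘ σ, ε₀) := h.somePath.extend_one
  have hmem (s : ℝ) (hs : s ∈ Set.Icc (0 : ℝ) 1) : p s ∈ frames (theFiber f g t₀ ε₀) f g := by
    rw [hp, Path.extend_apply _ hs]
    exact h.somePath_mem _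
  have hval (b : theFiber f g t₀ ε₀) : (pencil f g ε₀).eval b.1 = t₀ := by
    rw [eval_pencil, b.2]
  refine ⟨fun s => (((pencil f g (p s).2).eval ((p s).1 b₀) : ℂ), (p s).2), ?_, ?_, ?_, ?_, ?_⟩
  · refine Continuous.continuousOn ((OnePoint.continuous_coe.comp ?_).prodMk hpc.snd)
    simp only [eval_pencil]
    fun_prop
  · simp only [hp0, hval]
  · simp only [hp1, Function.comp_apply, hval]
  · rintro s hs (h | ⟨t, ht, h | ⟨w, hw, hw'⟩⟩)
    · exact OnePoint.coe_ne_infty _ h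
    · exact (hmem s hs).1 h
    · rw [OnePoint.coe_eq_coe] at ht
      refine (mem_range_of_mem_frames hn hι (hmem s hs) (b := b₀) (z := w) ?_).2 ?_
      · rw [ht, eval_pencil, hw]
      · simpa [pencil] using hw'
  · intro x
    refine ⟨fun s => (p s).1 x, ?_, congrArg (fun q => q.1 x) hp0,
      congrArg (fun q => q.1 x) hp1, fun s hs => ?_⟩
    · exact ((continuous_apply x).comp hpc.fst).continuousOn
    · rw [OnePoint.coe_eq_coe, ← eval_pencil]
      exact (hmem s hs).2.2 x b₀

/-- Continuation of a block along two paths gives sets that coincide if they meet. -/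
theorem image_eq_image_of_block [Fintype (theFiber f g t₀ ε₀)] (hn : defDeg f g ≠ 0)
    (hι : Fintype.card (theFiber f g t₀ ε₀) = defDeg f g) {B : Set (theFiber f g t₀ ε₀)}
    (hB : ∀ σ ∈ MonodromyGroup f g t₀ ε₀,
      ((fun x => σ x) '' B) ∩ B = ∅ ∨ (fun x => σ x) '' B = B)
    {v v' : theFiber f g t₀ ε₀ → ℂ} {ε : ℂ}
    (hv : JoinedIn (frames (theFiber f g t₀ ε₀) f g) (Subtype.val, ε₀) (v, ε))
    (hv' : JoinedIn (frames (theFiber f g t₀ ε₀) f g) (Subtype.val, ε₀) (v', ε))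
    {b b' : theFiber f g t₀ ε₀} (hb : b ∈ B) (hb' : b' ∈ B) (h : v b = v' b') :
    v '' B = v' '' B := by
  obtain ⟨π, rfl⟩ := exists_perm_of_mem_frames hn hι hv.target_mem hv'.target_mem h
  have hπ : π ∈ MonodromyGroup f g t₀ ε₀ := Subgroup.subset_closure
    (isMonodromyPerm_of_joinedIn_frames hn hι (hv'.trans (hv.frames_comp π).symm))
  have hbb : b = π b' := hv.target_mem.2.1 h
  rw [Set.image_comp]
  rcases hB π hπ with h0 | h1
  · exact absurd h0 (Set.Nonempty.ne_empty ⟨b, ⟨b', hb', hbb.symm⟩, hb⟩)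
  · exact congrArg (v '' ·) h1.symm

end Monodromy

section Blocks

variable {ι : Type*} [Fintype ι] {f g : ℂ[X]}

/-- The elementary symmetric function `∏ (x - z_b)` over a continued block of roots, as a function
of one of these roots, is a polynomial. -/
theorem exists_polynomial_eval_eq_prod (hn : defDeg f g ≠ 0) (hι : Fintype.card ι = defDeg f g)
    {ε x : ℂ} (hε : leadC f g ε ≠ 0) {B : Finset ι} {b₀ : ι} (hb₀ : b₀ ∈ B) {R : Set (ι → ℂ)}
    (hR : ∀ v ∈ R, ∀ v', JoinedIn (frames ι f g) (v, ε) (v', ε) → v' ∈ R)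
    (hRf : ∀ v ∈ R, (v, ε) ∈ frames ι f g)
    (hS : {z | ∃ v ∈ R, v b₀ = z}ᶜ.Finite)
    (hblock : ∀ v ∈ R, ∀ v' ∈ R, ∀ b ∈ B, ∀ b' ∈ B, v b = v' b' → v '' B = v' '' B) :
    ∃ h : ℂ[X], h.natDegree ≤ B.card ∧ ∀ v ∈ R, h.eval (v b₀) = ∏ b ∈ B, (x - v b) := by
  classical
  have hP := natDegree_pencil hε
  obtain ⟨K, -, hK⟩ := exists_norm_le_of_eval_eq (P := pencil f g ε) (hP.trans_ne hn)
  set S := {z | ∃ v ∈ R, v b₀ = z} with hSdef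
  have hprod (v : ι → ℂ) (hv : v ∈ R) (v' : ι → ℂ) (hv' : v' ∈ R) (h : v b₀ = v' b₀) :
      ∏ b ∈ B, (x - v b) = ∏ b ∈ B, (x - v' b) := by
    have himg : B.image v = B.image v' := by
      rw [← Finset.coe_inj, Finset.coe_image, Finset.coe_image]
      exact hblock v hv v' hv' b₀ hb₀ b₀ hb₀ h
    rw [← Finset.prod_image (f := fun w => x - w) (hRf v hv).2.1.injOn, himg,
      Finset.prod_image (hRf v' hv').2.1.injOn]
  have hV (z : ℂ) : ∃ v : ι → ℂ, z ∈ S → v ∈ R ∧ v b₀ = z := by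
    by_cases hz : z ∈ S
    · obtain ⟨v, hv, hvz⟩ := hz
      exact ⟨v, fun _ => ⟨hv, hvz⟩⟩
    · exact ⟨0, fun h => absurd h hz⟩
  choose V hV using hV
  set u : ℂ → ℂ := fun z => ∏ b ∈ B, (x - V z b) with hu
  have hdiff (z : ℂ) (hz : z ∉ Sᶜ) : DifferentiableAt ℂ u z := by
    obtain ⟨hVR, hVz⟩ := hV z (not_not.1 hz)
    obtain ⟨φ, hφ⟩ := exists_slice_frame hn hι (hRf _ hVR) b₀
    rw [hVz] at hφ
    have hφd : DifferentiableAt ℂ φ z := hφ.self_of_nhds.1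
    have hd : DifferentiableAt ℂ (fun z' => ∏ b ∈ B, (x - φ z' b)) z :=
      DifferentiableAt.fun_finsetProd fun b _ =>
        (differentiableAt_const x).sub (differentiableAt_pi.1 hφd b)
    refine hd.congr_of_eventuallyEq ?_
    filter_upwards [hφ] with z' hz'
    have hmem := hR _ hVR _ hz'.2.1
    obtain ⟨h1, h2⟩ := hV z' ⟨_, hmem, hz'.2.2⟩
    exact hprod _ h1 _ hmem (h2.trans hz'.2.2.symm)
  set b : ℂ → ℝ := fun z => (‖x‖ + K) ^ B.card * max 1 ‖z‖ ^ B.card with hb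
  have hub (z : ℂ) (hz : z ∉ Sᶜ) : ‖u z‖ ≤ b z := by
    obtain ⟨hVR, hVz⟩ := hV z (not_not.1 hz)
    rw [hu, hb]
    simp only
    rw [norm_prod, ← mul_pow]
    rw [← Finset.prod_const]
    refine Finset.prod_le_prod (fun c _ => norm_nonneg _) fun c _ => ?_
    have h1 := hK z (V z c) (((hRf _ hVR).2.2 c b₀).trans
      (congrArg (fun w => (pencil f g ε).eval w) hVz))
    have h2 : ‖x‖ ≤ ‖x‖ * max 1 ‖z‖ := le_mul_of_one_le_right (norm_nonneg _) (le_max_left _ _)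
    calc ‖x - V z c‖ ≤ ‖x‖ + ‖V z c‖ := norm_sub_le _ _
      _ ≤ (‖x‖ + K) * max 1 ‖z‖ := by linarith
  have hbc : Continuous b := by fun_prop
  obtain ⟨U, hU, hUu⟩ := exists_differentiable_extension hS hdiff hbc hub
  have hdense : Dense S := by
    have := hS.countable.dense_compl ℝ
    rwa [compl_compl] at this
  have hUb (z : ℂ) : ‖U z‖ ≤ b z :=
    (isClosed_le hU.continuous.norm hbc).closure_subset_iff.2
      (fun w hw => by
        change ‖U w‖ ≤ b w
        rw [hUu w (not_not.2 hw)]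
        exact hub w (not_not.2 hw)) (hdense z)
  obtain ⟨h, hdeg, hh⟩ := exists_polynomial_of_growth hU hUb
  refine ⟨h, hdeg, fun v hv => ?_⟩
  have hvS : v b₀ ∈ S := ⟨v, hv, rfl⟩
  obtain ⟨h1, h2⟩ := hV _ hvS
  rw [hh, hUu _ (not_not.2 hvS)]
  exact hprod _ h1 _ hv h2

/-- A system of blocks of continued roots makes the member of the pencil decomposable. -/
theorem exists_pencil_eq_comp_of_block (hn : defDeg f g ≠ 0) (hι : Fintype.card ι = defDeg f g)
    {x₀ : (ι → ℂ) × ℂ} {v₁ : ι → ℂ} {ε : ℂ} (h₁ : JoinedIn (frames ι f g) x₀ (v₁, ε))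
    {B : Finset ι} (hBne : B.Nonempty)
    (hblock : ∀ v v', JoinedIn (frames ι f g) x₀ (v, ε) → JoinedIn (frames ι f g) x₀ (v', ε) →
      ∀ b ∈ B, ∀ b' ∈ B, v b = v' b' → v '' B = v' '' B) :
    ∃ F h : ℂ[X], h.natDegree = B.card ∧ pencil f g ε = F.comp h := by
  classical
  obtain ⟨b₀, hb₀⟩ := hBne
  have hε : leadC f g ε ≠ 0 := h₁.target_mem.1
  set S := {z | ∃ v, JoinedIn (frames ι f g) x₀ (v, ε) ∧ v b₀ = z} with hSdef
  have hS : Sᶜ.Finite := by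
    refine (finite_not_mem_frames hn hι hε b₀).subset (Set.compl_subset_compl.2 ?_)
    rintro _ ⟨v, hv, rfl⟩
    exact exists_joinedIn_frames_apply_eq hn hι h₁ b₀ hv
  have hSinf : S.Infinite := fun hfin => Set.infinite_univ (by
    rw [← Set.union_compl_self S]
    exact hfin.union hS)
  obtain ⟨h, hdeg, hh⟩ := exists_polynomial_eval_eq_prod (x := v₁ b₀) hn hι hε hb₀
    (R := {v | JoinedIn (frames ι f g) x₀ (v, ε)}) (fun v hv v' hv' => hv.trans hv')
    (fun v hv => hv.target_mem) hS (fun v hv v' hv' => hblock v v' hv hv')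
  have hroot (b : ι) (hb : b ∈ B) : h.eval (v₁ b) = 0 := by
    obtain ⟨v, hv, hvb⟩ := exists_joinedIn_frames_apply_eq hn hι h₁ b₀
      (v := v₁ ∘ Equiv.swap b₀ b) ⟨hε, h₁.target_mem.2.1.comp (Equiv.injective _),
        fun c d => h₁.target_mem.2.2 _ _⟩
    simp only [Function.comp_apply, Equiv.swap_apply_left] at hvb
    rw [← hvb, hh v hv]
    have himg := hblock v v₁ hv h₁ b₀ hb₀ b hb hvb
    obtain ⟨c, hc, hcv⟩ : v₁ b₀ ∈ v '' B := himg ▸ ⟨b₀, hb₀, rfl⟩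
    exact Finset.prod_eq_zero hc (by rw [hcv, sub_self])
  have h0 : h ≠ 0 := by
    rintro rfl
    obtain ⟨_, ⟨v, hv, rfl⟩, hvB⟩ := (hSinf.sdiff (B.image v₁).finite_toSet).nonempty
    have := hh v hv
    rw [eval_zero] at this
    obtain ⟨c, hc, hcv⟩ := Finset.prod_eq_zero_iff.1 this.symm
    have himg := hblock v v₁ hv h₁ c hc b₀ hb₀ (sub_eq_zero.1 hcv).symm
    apply hvB
    rw [Finset.coe_image, ← himg]
    exact ⟨b₀, hb₀, rfl⟩
  have hcard : h.natDegree = B.card := by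
    refine hdeg.antisymm ?_
    rw [← Finset.card_image_of_injective B h₁.target_mem.2.1]
    refine Polynomial.card_le_degree_of_subset_roots (p := h) ?_
    intro z hz
    obtain ⟨b, hb, rfl⟩ := Finset.mem_image.1 (show z ∈ B.image v₁ from hz)
    exact (mem_roots h0).2 (hroot b hb)
  have hh0 : h.natDegree ≠ 0 := hcard.trans_ne (Finset.card_ne_zero_of_mem hb₀)
  have hA : (h.eval '' S).Infinite := fun hfin => hSinf (by
    refine (hfin.preimage' fun c _ => ?_).subset (Set.subset_preimage_image _ _)
    have h0 : h - C c ≠ 0 := fun h0 => hh0 (by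
      rw [← natDegree_sub_C (a := c), h0, natDegree_zero])
    refine (h - C c).roots.toFinset.finite_toSet.subset fun z hz => ?_
    simpa [h0, sub_eq_zero] using hz)
  obtain ⟨F, hF⟩ := exists_eq_comp_of_constant_on_fibers (P := pencil f g ε) hh0 hA (by
    rintro _ ⟨_, ⟨v, hv, rfl⟩, rfl⟩
    refine ⟨B.image v, ?_, ?_, (pencil f g ε).eval (v b₀), ?_⟩
    · rw [Finset.card_image_of_injective B hv.target_mem.2.1, hcard]
    · intro z hz
      obtain ⟨b, hb, rfl⟩ := Finset.mem_image.1 hz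
      obtain ⟨v', hv', hvb⟩ := exists_joinedIn_frames_apply_eq hn hι h₁ b₀
        (v := v ∘ Equiv.swap b₀ b) ⟨hε, hv.target_mem.2.1.comp (Equiv.injective _),
          fun c d => hv.target_mem.2.2 _ _⟩
      simp only [Function.comp_apply, Equiv.swap_apply_left] at hvb
      have himg : B.image v' = B.image v := by
        rw [← Finset.coe_inj, Finset.coe_image, Finset.coe_image]
        exact hblock v' v hv' hv b₀ hb₀ b hb hvb
      rw [← hvb, hh v' hv']
      change _ = h.eval (v b₀)
      rw [hh v hv, ← Finset.prod_image (f := fun w => v₁ b₀ - w) hv'.target_mem.2.1.injOn, himg,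
        Finset.prod_image hv.target_mem.2.1.injOn]
    · intro z hz
      obtain ⟨b, -, rfl⟩ := Finset.mem_image.1 hz
      exact hv.target_mem.2.2 b b₀)
  exact ⟨F, h, hcard, hF⟩

end Blocks

/-!
STATEMENT 11 (the imprimitive case).

If the monodromy group `G` of the deformation `f + ε g` is imprimitive, then
there exist polynomials `F(z,ε) = F₀(z) + ε F₁(z)` (affine in `ε`) and
`h ∈ ℂ[z]`, both of degree `> 1` in `z`, with `f(z) + ε g(z) = F(h(z), ε)`;
equivalently `f = F₀ ∘ h` and `g = F₁ ∘ h` have the nontrivial common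
polynomial composition factor `h`.
-/
theorem imprimitive_monodromy_gives_composition_factor
    (f g : Polynomial ℂ) (t₀ ε₀ : ℂ)
    (hbase : ((t₀ : OnePoint ℂ), ε₀) ∉ sigmaSet f g)
    (himp : IsImprimitive (MonodromyGroup f g t₀ ε₀)) :
    ∃ F₀ F₁ h : Polynomial ℂ,
      f = F₀.comp h ∧ g = F₁.comp h ∧
      1 < h.natDegree ∧ 1 < max F₀.natDegree F₁.natDegree ∧
      ∀ ε : ℂ, f + C ε * g = (F₀ + C ε * F₁).comp h := by
  classical
  obtain ⟨B, ⟨x, hx, y, hy, hxy⟩, hBuniv, hB⟩ := himp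
  have hsig : (t₀, ε₀) ∉ sigmaFin f g := fun h => hbase (Or.inr ⟨t₀, rfl, h⟩)
  have hlead : leadC f g ε₀ ≠ 0 := fun h => hsig (Or.inl h)
  have hder (w : ℂ) (hw : (pencil f g ε₀).eval w = t₀) :
      (pencil f g ε₀).derivative.eval w ≠ 0 := fun h =>
    hsig (Or.inr ⟨w, by rw [← hw, eval_pencil], by simpa [pencil] using h⟩)
  have hdeg := natDegree_pencil hlead
  have hn : defDeg f g ≠ 0 := fun hn => by
    refine hder x.1 (by rw [eval_pencil, x.2]) ?_
    rw [derivative_eq_zero.2 (hdeg.trans hn), eval_zero]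
  obtain ⟨s, hs, hsmem⟩ := exists_finset_fiber (hdeg.trans_ne hn) hder
  let _ : Fintype (theFiber f g t₀ ε₀) :=
    Fintype.subtype s fun w => by rw [hsmem, eval_pencil]
  have hι : Fintype.card (theFiber f g t₀ ε₀) = defDeg f g := by
    rw [← hdeg, ← hs]
    exact Fintype.card_of_subtype s fun w => by rw [hsmem, eval_pencil]
  have hfr : ((Subtype.val : theFiber f g t₀ ε₀ → ℂ), ε₀) ∈ frames (theFiber f g t₀ ε₀) f g :=
    ⟨hlead, Subtype.val_injective, fun b c => by
      rw [eval_pencil, eval_pencil]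
      exact b.2.trans c.2.symm⟩
  have hm1 : 1 < B.toFinset.card :=
    Finset.one_lt_card.2 ⟨x, by simpa using hx, y, by simpa using hy, hxy⟩
  have hmn : B.toFinset.card < defDeg f g := by
    rw [← hι]
    exact Finset.card_lt_univ_of_notMem
      (Set.mem_toFinset.not.2 (Set.ne_univ_iff_exists_notMem B |>.1 hBuniv).choose_spec)
  have : Nonempty (theFiber f g t₀ ε₀) := ⟨x⟩
  have hA := infinite_of_mem_nhds ε₀ (eventually_exists_joinedIn_frames hn hι hfr)
  obtain ⟨F₀, F₁, h, hh, hf, hg⟩ := exists_common_comp_of_infinite hA (by omega) hmn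
    (fun ε ⟨v, hv⟩ => hv.target_mem.1) (fun ε ⟨v, hv⟩ =>
      exists_pencil_eq_comp_of_block hn hι hv (Finset.card_pos.1 (by omega))
        fun v v' hv hv' b hb b' hb' hbb => by
          rw [Set.coe_toFinset]
          exact image_eq_image_of_block hn hι hB hv hv' (Set.mem_toFinset.1 hb)
            (Set.mem_toFinset.1 hb') hbb)
  refine ⟨F₀, F₁, h, hf, hg, hh ▸ hm1, ?_, fun ε => ?_⟩
  · by_contra! hle
    have h0 : F₀.natDegree ≤ 1 := (le_max_left _ _).trans hle
    have h1 : F₁.natDegree ≤ 1 := (le_max_right _ _).trans hle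
    refine hmn.not_ge (max_le ?_ ?_)
    · refine (congrArg natDegree hf).trans_le ?_
      rw [natDegree_comp, hh]
      exact (Nat.mul_le_mul_right _ h0).trans_eq (one_mul _)
    · refine (congrArg natDegree hg).trans_le ?_
      rw [natDegree_comp, hh]
      exact (Nat.mul_le_mul_right _ h1).trans_eq (one_mul _)
  · rw [add_comp, mul_comp, C_comp, ← hf, ← hg]

end
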